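/- For all a, b, c, p > 0 with a > b + c, ∫₀^∞ (1/(τ² + p²)) J₁(aτ) J₁(bτ) J₁(cτ) dτ = p^{-1} K₁(ap) I₁(bp) I₁(cp). -/

import Mathlib

open MeasureTheory Filter

/-- Bessel function of the first kind of order `k` (integral representation). -/
noncomputable def besselJ (k : ℕ) (r : ℝ) : ℝ :=
  (r / 2) ^ k / (Real.sqrt Real.pi * Real.Gamma ((k : ℝ) + 1 / 2)) *
    ∫ θ in (0:ℝ)..Real.pi, Real.cos (r * Real.cos θ) * Real.sin θ ^ (2 * k)

/-- Modified Bessel function of the first kind of order `k`. -/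
noncomputable def besselI (k : ℕ) (r : ℝ) : ℝ :=
  (r / 2) ^ k / (Real.sqrt Real.pi * Real.Gamma ((k : ℝ) + 1 / 2)) *
    ∫ θ in (0:ℝ)..Real.pi, Real.exp (r * Real.cos θ) * Real.sin θ ^ (2 * k)

/-- Modified Bessel function of the second kind of order `k`. -/
noncomputable def besselK (k : ℕ) (r : ℝ) : ℝ :=
  ∫ t in Set.Ioi (0:ℝ), Real.exp (-(r * Real.cosh t)) * Real.cosh ((k : ℝ) * t)

/-- The entire function `J₁(r) / r`, by the Poisson integral. -/
noncomputable def poissonJ (r : ℝ) : ℝ :=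
  Real.pi⁻¹ * ∫ θ in (0:ℝ)..Real.pi, Real.cos (r * Real.cos θ) * Real.sin θ ^ 2

lemma sqrt_pi_mul_Gamma_three_halves :
    Real.sqrt Real.pi * Real.Gamma (((1 : ℕ) : ℝ) + 1 / 2) = Real.pi / 2 := by
  rw [Real.Gamma_nat_add_half]
  have h := Real.mul_self_sqrt Real.pi_pos.le
  simp only [mul_one, Nat.add_one_sub_one, Nat.doubleFactorial, Nat.cast_one, one_mul, pow_one]
  linear_combination h / 2

lemma besselJ_one_eq_mul_poissonJ (r : ℝ) : besselJ 1 r = r * poissonJ r := by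
  unfold besselJ poissonJ
  rw [sqrt_pi_mul_Gamma_three_halves]
  have := Real.pi_pos.ne'
  field_simp

lemma besselJ_one_eq_integral_sin (r : ℝ) :
    besselJ 1 r = Real.pi⁻¹ * ∫ θ in (0:ℝ)..Real.pi, Real.sin (r * Real.cos θ) * Real.cos θ := by
  rw [besselJ_one_eq_mul_poissonJ, poissonJ]
  have h := intervalIntegral.integral_mul_deriv_eq_deriv_mul (a := 0) (b := Real.pi)
    (u := fun θ => Real.sin (r * Real.cos θ)) (v := Real.sin)
    (u' := fun θ => Real.cos (r * Real.cos θ) * (r * -Real.sin θ)) (v' := Real.cos)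
    (fun θ _ => ((Real.hasDerivAt_cos θ).const_mul r).sin) (fun θ _ => Real.hasDerivAt_sin θ)
    (Continuous.intervalIntegrable (by fun_prop) _ _)
    (Continuous.intervalIntegrable (by fun_prop) _ _)
  rw [h, mul_left_comm, ← intervalIntegral.integral_const_mul]
  simp only [Real.sin_pi, Real.sin_zero, mul_zero, sub_self, zero_sub,
    ← intervalIntegral.integral_neg]
  congr 1
  refine intervalIntegral.integral_congr fun θ _ => ?_
  ring_nf

lemma besselI_one_eq_integral_exp (r : ℝ) :
    besselI 1 r = Real.pi⁻¹ * ∫ θ in (0:ℝ)..Real.pi, Real.exp (r * Real.cos θ) * Real.cos θ := by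
  have h := intervalIntegral.integral_mul_deriv_eq_deriv_mul (a := 0) (b := Real.pi)
    (u := fun θ => Real.exp (r * Real.cos θ)) (v := Real.sin)
    (u' := fun θ => Real.exp (r * Real.cos θ) * (r * -Real.sin θ)) (v' := Real.cos)
    (fun θ _ => ((Real.hasDerivAt_cos θ).const_mul r).exp) (fun θ _ => Real.hasDerivAt_sin θ)
    (Continuous.intervalIntegrable (by fun_prop) _ _)
    (Continuous.intervalIntegrable (by fun_prop) _ _)
  have hpi := Real.pi_pos.ne'
  rw [h, besselI, sqrt_pi_mul_Gamma_three_halves,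
    show (r / 2) ^ 1 / (Real.pi / 2) = Real.pi⁻¹ * r by field_simp, mul_assoc,
    ← intervalIntegral.integral_const_mul]
  simp only [Real.sin_pi, Real.sin_zero, mul_zero, sub_self, zero_sub,
    ← intervalIntegral.integral_neg]
  congr 1
  refine intervalIntegral.integral_congr fun θ _ => ?_
  ring_nf

lemma besselI_one_eq_integral_sinh (r : ℝ) :
    besselI 1 r =
      Real.pi⁻¹ * ∫ θ in (0:ℝ)..Real.pi, Real.sinh (r * Real.cos θ) * Real.cos θ := by
  have hrefl : ∫ θ in (0:ℝ)..Real.pi, Real.exp (-(r * Real.cos θ)) * Real.cos θ =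
      -∫ θ in (0:ℝ)..Real.pi, Real.exp (r * Real.cos θ) * Real.cos θ := by
    have h := intervalIntegral.integral_comp_sub_left (a := 0) (b := Real.pi)
      (fun θ => Real.exp (r * Real.cos θ) * Real.cos θ) Real.pi
    rw [sub_self, sub_zero] at h
    rw [← h, ← intervalIntegral.integral_neg]
    refine intervalIntegral.integral_congr fun θ _ => ?_
    simp [Real.cos_pi_sub]
  rw [besselI_one_eq_integral_exp]
  congr 1
  have hsub := intervalIntegral.integral_sub (μ := volume) (a := 0) (b := Real.pi)
    (f := fun θ => Real.exp (r * Real.cos θ) * Real.cos θ)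
    (g := fun θ => Real.exp (-(r * Real.cos θ)) * Real.cos θ)
    (Continuous.intervalIntegrable (by fun_prop) _ _)
    (Continuous.intervalIntegrable (by fun_prop) _ _)
  have hsinh : ∫ θ in (0:ℝ)..Real.pi, Real.sinh (r * Real.cos θ) * Real.cos θ =
      ∫ θ in (0:ℝ)..Real.pi, (2:ℝ)⁻¹ * (Real.exp (r * Real.cos θ) * Real.cos θ -
        Real.exp (-(r * Real.cos θ)) * Real.cos θ) := by
    refine intervalIntegral.integral_congr fun θ _ => ?_
    simp only [Real.sinh_eq]
    ring
  rw [hsinh, intervalIntegral.integral_const_mul, hsub, hrefl]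
  ring

lemma continuous_poissonJ : Continuous poissonJ := by
  unfold poissonJ
  refine continuous_const.mul
    (intervalIntegral.continuous_parametric_intervalIntegral_of_continuous' ?_ _ _)
  simp only [Function.uncurry_def]
  fun_prop

lemma continuous_besselJ_one : Continuous (besselJ 1) := by
  rw [show besselJ 1 = fun r => r * poissonJ r from funext besselJ_one_eq_mul_poissonJ]
  exact continuous_id.mul continuous_poissonJ

lemma abs_inv_pi_mul_integral_le_one {f : ℝ → ℝ} (hf : ∀ θ, |f θ| ≤ 1) :
    |Real.pi⁻¹ * ∫ θ in (0:ℝ)..Real.pi, f θ| ≤ 1 := by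
  have h := intervalIntegral.norm_integral_le_of_norm_le_const (a := 0) (b := Real.pi)
    (f := f) (C := 1) fun θ _ => hf θ
  have hpi := Real.pi_pos
  rw [sub_zero, abs_of_pos hpi, one_mul, Real.norm_eq_abs] at h
  rw [abs_mul, abs_of_pos (inv_pos.2 hpi), inv_mul_le_iff₀ hpi, mul_one]
  exact h

lemma abs_poissonJ_le_one (r : ℝ) : |poissonJ r| ≤ 1 := by
  refine abs_inv_pi_mul_integral_le_one fun θ => ?_
  rw [abs_mul, abs_of_nonneg (sq_nonneg (Real.sin θ))]
  exact mul_le_one₀ (Real.abs_cos_le_one _) (sq_nonneg _) (Real.sin_sq_le_one θ)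

lemma abs_besselJ_one_le_one (r : ℝ) : |besselJ 1 r| ≤ 1 := by
  rw [besselJ_one_eq_integral_sin]
  refine abs_inv_pi_mul_integral_le_one fun θ => ?_
  rw [abs_mul]
  exact mul_le_one₀ (Real.abs_sin_le_one _) (abs_nonneg _) (Real.abs_cos_le_one θ)

lemma exp_neg_mul_cosh_mul_cosh_sq_le {r : ℝ} (hr : 0 < r) (t : ℝ) :
    Real.exp (-(r * Real.cosh t)) * Real.cosh t ^ 2 ≤ 12 / r ^ 3 * Real.exp (-t) := by
  have hc := Real.cosh_pos t
  have h1 := Real.pow_div_factorial_le_exp (r * Real.cosh t) (by positivity) 3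
  have h2 : Real.exp t ≤ 2 * Real.cosh t := by
    rw [Real.cosh_eq]
    linarith [Real.exp_pos (-t)]
  rw [Real.exp_neg, Real.exp_neg, inv_mul_eq_div, ← div_eq_mul_inv, div_div,
    div_le_div_iff₀ (Real.exp_pos _) (by positivity)]
  have h3 : (r * Real.cosh t) ^ 3 ≤ 6 * Real.exp (r * Real.cosh t) := by
    rw [show ((Nat.factorial 3 : ℕ) : ℝ) = 6 by norm_num [Nat.factorial]] at h1
    linarith
  calc Real.cosh t ^ 2 * (r ^ 3 * Real.exp t)
      ≤ Real.cosh t ^ 2 * (r ^ 3 * (2 * Real.cosh t)) := by gcongr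
    _ = 2 * (r * Real.cosh t) ^ 3 := by ring
    _ ≤ 12 * Real.exp (r * Real.cosh t) := by linarith

lemma abs_sinh_le_cosh (t : ℝ) : |Real.sinh t| ≤ Real.cosh t :=
  abs_le_of_sq_le_sq (by nlinarith [Real.cosh_sq t]) (Real.cosh_pos t).le

lemma integrableOn_exp_neg_mul_cosh_mul {r : ℝ} (hr : 0 < r) {f : ℝ → ℝ} (hf : Continuous f)
    (hle : ∀ t, |f t| ≤ Real.cosh t ^ 2) :
    IntegrableOn (fun t => Real.exp (-(r * Real.cosh t)) * f t) (Set.Ioi 0) := by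
  refine Integrable.mono' (((integrableOn_exp_mul_Ioi (a := -1) (by norm_num) 0)).const_mul
    (12 / r ^ 3)) (Continuous.aestronglyMeasurable (by fun_prop)) (ae_of_all _ fun t => ?_)
  rw [Real.norm_eq_abs, abs_mul, Real.abs_exp, neg_one_mul]
  exact (mul_le_mul_of_nonneg_left (hle t) (Real.exp_pos _).le).trans
    (exp_neg_mul_cosh_mul_cosh_sq_le hr t)

lemma besselK_one_eq_integral_sinh_sq {r : ℝ} (hr : 0 < r) :
    besselK 1 r =
      r * ∫ t in Set.Ioi (0:ℝ), Real.exp (-(r * Real.cosh t)) * Real.sinh t ^ 2 := by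
  have hcosh : ∀ t, Real.cosh t ≤ Real.cosh t ^ 2 := fun t => by
    nlinarith [Real.one_le_cosh t]
  have hlim : Tendsto (fun t => Real.exp (-(r * Real.cosh t)) * Real.sinh t) atTop (nhds 0) := by
    refine squeeze_zero_norm (a := fun t => 12 / r ^ 3 * Real.exp (-t)) (fun t => ?_) ?_
    · rw [Real.norm_eq_abs, abs_mul, Real.abs_exp]
      exact (mul_le_mul_of_nonneg_left ((abs_sinh_le_cosh t).trans (hcosh t))
        (Real.exp_pos _).le).trans (exp_neg_mul_cosh_mul_cosh_sq_le hr t)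
    · simpa using (Real.tendsto_exp_neg_atTop_nhds_zero).const_mul (12 / r ^ 3)
  have h := integral_Ioi_mul_deriv_eq_deriv_mul (a := (0:ℝ)) (a' := (0:ℝ)) (b' := (0:ℝ))
    (u := fun t => Real.exp (-(r * Real.cosh t))) (v := Real.sinh)
    (u' := fun t => Real.exp (-(r * Real.cosh t)) * (-(r * Real.sinh t))) (v' := Real.cosh)
    (fun t _ => ((Real.hasDerivAt_cosh t).const_mul r).neg.exp)
    (fun t _ => Real.hasDerivAt_sinh t)
    (integrableOn_exp_neg_mul_cosh_mul hr Real.continuous_cosh fun t => by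
      rw [abs_of_pos (Real.cosh_pos t)]; exact hcosh t)
    (by
      have h2 := (integrableOn_exp_neg_mul_cosh_mul hr (f := fun t => Real.sinh t ^ 2)
        (by fun_prop) fun t => by
          rw [abs_pow]; exact pow_le_pow_left₀ (abs_nonneg _) (abs_sinh_le_cosh t) 2).const_mul (-r)
      refine h2.congr (ae_of_all _ fun t => ?_)
      simp only [Pi.mul_apply]
      ring)
    (by
      have hcont : Continuous fun t => Real.exp (-(r * Real.cosh t)) * Real.sinh t := by fun_prop
      have h0 := (hcont.tendsto 0).mono_left (nhdsWithin_le_nhds (s := Set.Ioi 0))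
      rwa [Real.sinh_zero, mul_zero] at h0)
    hlim
  simp only [besselK, Nat.cast_one, one_mul]
  rw [h, sub_self, zero_sub, ← integral_neg, ← integral_const_mul]
  congr 1
  ext t
  ring

lemma integrableOn_id_mul_exp_neg_mul_Ioi {p : ℝ} (hp : 0 < p) :
    IntegrableOn (fun s => s * Real.exp (-(p * s))) (Set.Ioi 0) := by
  have h := integrableOn_rpow_mul_exp_neg_mul_rpow (s := 1) (p := 1) (b := p)
    (by norm_num) (by norm_num) hp
  refine h.congr_fun (fun s _ => ?_) measurableSet_Ioi
  simp

lemma integral_id_mul_exp_neg_mul_Ioi {p : ℝ} (hp : 0 < p) :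
    ∫ s in Set.Ioi (0:ℝ), s * Real.exp (-(p * s)) = 1 / p ^ 2 := by
  have h := Real.integral_rpow_mul_exp_neg_mul_Ioi (a := 2) (r := p) (by norm_num) hp
  norm_num [Real.Gamma_two] at h
  rw [h]
  simp

/-- Laplace transform of `√(y² - a²)` in terms of `K₁`. -/
lemma integral_exp_neg_mul_sqrt_sq_sub_sq {a p : ℝ} (ha : 0 < a) (hp : 0 < p) :
    ∫ y in Set.Ioi a, Real.exp (-(p * y)) * Real.sqrt (y ^ 2 - a ^ 2) =
      a / p * besselK 1 (a * p) := by
  have hsqrt : ∀ t ∈ Set.Ici (0:ℝ),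
      Real.sqrt ((a * Real.cosh t) ^ 2 - a ^ 2) = a * Real.sinh t := fun t ht => by
    rw [show (a * Real.cosh t) ^ 2 - a ^ 2 = (a * Real.sinh t) ^ 2 by rw [mul_pow, Real.cosh_sq]; ring]
    exact Real.sqrt_sq (mul_nonneg ha.le (Real.sinh_nonneg_iff.2 ht))
  have heq : Set.EqOn (fun t => a ^ 2 * (Real.exp (-(a * p * Real.cosh t)) * Real.sinh t ^ 2))
      (fun t => ((fun y => Real.exp (-(p * y)) * Real.sqrt (y ^ 2 - a ^ 2)) ∘
        fun t => a * Real.cosh t) t * (a * Real.sinh t)) (Set.Ici 0) := fun t ht => by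
    simp only [Function.comp_apply, hsqrt t ht]
    rw [show p * (a * Real.cosh t) = a * p * Real.cosh t by ring]
    ring
  have hint := (integrableOn_exp_neg_mul_cosh_mul (mul_pos ha hp)
    (f := fun t => Real.sinh t ^ 2) (by fun_prop) fun t => by
      rw [abs_pow]; exact pow_le_pow_left₀ (abs_nonneg _) (abs_sinh_le_cosh t) 2).const_mul (a ^ 2)
  have h := MeasureTheory.integral_comp_mul_deriv_Ioi (a := 0) (f := fun t => a * Real.cosh t)
    (f' := fun t => a * Real.sinh t)
    (g := fun y => Real.exp (-(p * y)) * Real.sqrt (y ^ 2 - a ^ 2))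
    (by fun_prop)
    (by
      refine Tendsto.const_mul_atTop ha (tendsto_atTop_mono (fun t => ?_)
        (Real.tendsto_exp_atTop.const_mul_atTop (by norm_num : (0:ℝ) < 1 / 2)))
      rw [Real.cosh_eq]
      linarith [Real.exp_pos (-t)])
    (fun t _ => ((Real.hasDerivAt_cosh t).const_mul a).hasDerivWithinAt)
    (by fun_prop)
    (by
      have hsub : (fun t => a * Real.cosh t) '' Set.Ici 0 ⊆ Set.Ioi 0 := by
        rintro _ ⟨t, -, rfl⟩
        exact mul_pos ha (Real.cosh_pos t)
      refine IntegrableOn.mono_set ?_ hsub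
      refine Integrable.mono' (integrableOn_id_mul_exp_neg_mul_Ioi hp)
        (Continuous.aestronglyMeasurable (by fun_prop)) ?_
      refine (ae_restrict_iff' measurableSet_Ioi).2 (ae_of_all _ fun y hy => ?_)
      rw [Real.norm_eq_abs, abs_mul, Real.abs_exp, abs_of_nonneg (Real.sqrt_nonneg _), mul_comm]
      gcongr
      exact Real.sqrt_le_iff.2 ⟨le_of_lt hy, by nlinarith⟩)
    (((integrableOn_Ici_iff_integrableOn_Ioi (by simp)).2 hint).congr_fun heq measurableSet_Ici)
  simp only [Real.cosh_zero, mul_one] at h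
  rw [← h, ← setIntegral_congr_fun measurableSet_Ioi (heq.mono Set.Ioi_subset_Ici_self),
    integral_const_mul, besselK_one_eq_integral_sinh_sq (mul_pos ha hp)]
  field_simp

lemma integral_exp_neg_mul_sin_Ioi {p : ℝ} (hp : 0 < p) (u : ℝ) :
    ∫ s in Set.Ioi (0:ℝ), Real.exp (-(p * s)) * Real.sin (u * s) = u / (u ^ 2 + p ^ 2) := by
  have hre : (-p + u * Complex.I : ℂ).re < 0 := by simpa using hp
  have h := congrArg Complex.im (integral_exp_mul_complex_Ioi hre 0)
  have him := integral_im (integrableOn_exp_mul_complex_Ioi hre 0)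
  simp only [RCLike.im_to_complex] at him
  rw [← him] at h
  convert h using 1
  · refine setIntegral_congr_fun measurableSet_Ioi fun s _ => ?_
    simp [Complex.exp_im]
  · simp [Complex.div_im, Complex.normSq_apply]
    ring

lemma integral_exp_neg_mul_cos_Ioi {p : ℝ} (hp : 0 < p) (u : ℝ) :
    ∫ s in Set.Ioi (0:ℝ), Real.exp (-(p * s)) * Real.cos (u * s) = p / (u ^ 2 + p ^ 2) := by
  have hre : (-p + u * Complex.I : ℂ).re < 0 := by simpa using hp
  have h := congrArg Complex.re (integral_exp_mul_complex_Ioi hre 0)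
  have hre' := integral_re (integrableOn_exp_mul_complex_Ioi hre 0)
  simp only [RCLike.re_to_complex] at hre'
  rw [← hre'] at h
  convert h using 1
  · refine setIntegral_congr_fun measurableSet_Ioi fun s _ => ?_
    simp [Complex.exp_re]
  · simp [Complex.div_re, Complex.normSq_apply]
    ring

lemma integral_mul_intervalIntegral_swap {Q : ℝ → ℝ} (hQ : IntegrableOn Q (Set.Ioi 0))
    {k : ℝ → ℝ → ℝ} (hk : Continuous (Function.uncurry k)) (hb : ∀ τ θ, |k τ θ| ≤ 1) :
    ∫ τ in Set.Ioi (0:ℝ), Q τ * ∫ θ in (0:ℝ)..Real.pi, k τ θ =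
      ∫ θ in (0:ℝ)..Real.pi, ∫ τ in Set.Ioi (0:ℝ), Q τ * k τ θ := by
  simp only [intervalIntegral.integral_of_le Real.pi_pos.le, ← integral_const_mul]
  refine integral_integral_swap ?_
  have h1 : Integrable (fun x : ℝ × ℝ => Q x.1) ((volume.restrict (Set.Ioi 0)).prod
      (volume.restrict (Set.Ioc 0 Real.pi))) := hQ.comp_fst _
  exact h1.mul_bdd (c := 1) hk.aestronglyMeasurable (ae_of_all _ fun x => hb x.1 x.2)

lemma integral_sin_sq_div_add_cos_sq {a z : ℝ} (ha : 0 < a) (hz : 0 < z) :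
    ∫ θ in (0:ℝ)..Real.pi, z * Real.sin θ ^ 2 / ((a * Real.cos θ) ^ 2 + z ^ 2) =
      Real.pi * (Real.sqrt (z ^ 2 + a ^ 2) - z) / a ^ 2 := by
  set w := Real.sqrt (z ^ 2 + a ^ 2) with hw
  have hwpos : 0 < w := Real.sqrt_pos.2 (by positivity)
  have hwsq : w ^ 2 = z ^ 2 + a ^ 2 := Real.sq_sqrt (by positivity)
  have hden : ∀ θ, 0 < w * Real.cos θ ^ 2 + z * Real.sin θ ^ 2 := fun θ => by
    have h1 := Real.sin_sq_add_cos_sq θ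
    have hmin : 0 < min w z := lt_min hwpos hz
    nlinarith [min_le_left w z, min_le_right w z, sq_nonneg (Real.sin θ), sq_nonneg (Real.cos θ)]
  have hderiv : ∀ θ, HasDerivAt (fun θ => w / a ^ 2 * (θ - Real.arctan
      ((w - z) * (Real.sin θ * Real.cos θ) / (w * Real.cos θ ^ 2 + z * Real.sin θ ^ 2))) -
        z / a ^ 2 * θ)
      (z * Real.sin θ ^ 2 / ((a * Real.cos θ) ^ 2 + z ^ 2)) θ := fun θ => by
    have hs := Real.hasDerivAt_sin θ
    have hc := Real.hasDerivAt_cos θ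
    have hN := (hs.mul hc).const_mul (w - z)
    have hD := ((hc.pow 2).const_mul w).add ((hs.pow 2).const_mul z)
    have h := (((hasDerivAt_id θ).sub (hN.div hD (hden θ).ne').arctan).const_mul (w / a ^ 2)).sub
      ((hasDerivAt_id θ).const_mul (z / a ^ 2))
    refine HasDerivAt.congr_deriv h ?_
    simp only [Pi.add_apply, Pi.mul_apply, Pi.pow_apply, Pi.div_apply]
    have hd := hden θ
    have h1 := Real.sin_sq_add_cos_sq θ
    clear h hN hD hs hc hw hden
    generalize Real.sin θ = s at *
    generalize Real.cos θ = c at *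
    have hsq : (w * c ^ 2 + z * s ^ 2) ^ 2 + ((w - z) * (s * c)) ^ 2 = (a * c) ^ 2 + z ^ 2 := by
      linear_combination (w ^ 2 * c ^ 2 + z ^ 2 * s ^ 2) * h1 + c ^ 2 * hwsq + z ^ 2 * h1
    have hq : (a * c) ^ 2 + z ^ 2 ≠ 0 := by positivity
    have hfrac : 1 / (1 + ((w - z) * (s * c) / (w * c ^ 2 + z * s ^ 2)) ^ 2) =
        (w * c ^ 2 + z * s ^ 2) ^ 2 / ((a * c) ^ 2 + z ^ 2) := by
      rw [← hsq]
      field_simp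
    rw [hfrac]
    have hnum : (w - z) * (c * c + s * -s) * (w * c ^ 2 + z * s ^ 2) - (w - z) * (s * c) *
        (w * ((2 : ℕ) * c ^ (2 - 1) * -s) + z * ((2 : ℕ) * s ^ (2 - 1) * c)) =
        (a * c) ^ 2 + z ^ 2 - w * z := by
      push_cast
      norm_num
      linear_combination (w ^ 2 * c ^ 2 + z ^ 2 * s ^ 2 - w * z * (s ^ 2 + c ^ 2) - w * z) * h1
        + c ^ 2 * hwsq + z ^ 2 * h1
    rw [hnum]
    field_simp
    linear_combination z * hwsq - a ^ 2 * z * h1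
  rw [intervalIntegral.integral_eq_sub_of_hasDerivAt (fun θ _ => hderiv θ)
    (Continuous.intervalIntegrable (by
      refine Continuous.div (by fun_prop) (by fun_prop) fun θ => ?_
      positivity) _ _)]
  simp
  ring

lemma integrableOn_exp_neg_mul_Ioi {z : ℝ} (hz : 0 < z) :
    IntegrableOn (fun τ => Real.exp (-(z * τ))) (Set.Ioi 0) := by
  simpa using exp_neg_integrableOn_Ioi 0 hz

lemma integral_exp_neg_mul_poissonJ {a z : ℝ} (ha : 0 < a) (hz : 0 < z) :
    ∫ τ in Set.Ioi (0:ℝ), Real.exp (-(z * τ)) * poissonJ (a * τ) =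
      (Real.sqrt (z ^ 2 + a ^ 2) - z) / a ^ 2 := by
  have hpi := Real.pi_pos.ne'
  simp only [poissonJ, mul_left_comm _ Real.pi⁻¹]
  rw [integral_const_mul, integral_mul_intervalIntegral_swap (integrableOn_exp_neg_mul_Ioi hz)
    (k := fun τ θ => Real.cos (a * τ * Real.cos θ) * Real.sin θ ^ 2)
    (by simp only [Function.uncurry_def]; fun_prop)]
  · have h : ∀ θ, ∫ τ in Set.Ioi (0:ℝ),
        Real.exp (-(z * τ)) * (Real.cos (a * τ * Real.cos θ) * Real.sin θ ^ 2) =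
        z * Real.sin θ ^ 2 / ((a * Real.cos θ) ^ 2 + z ^ 2) := fun θ => by
      rw [mul_comm z, mul_div_assoc, ← integral_exp_neg_mul_cos_Ioi hz, ← integral_const_mul]
      refine setIntegral_congr_fun measurableSet_Ioi fun τ _ => ?_
      simp only [mul_right_comm a τ]
      ring
    simp only [h]
    rw [integral_sin_sq_div_add_cos_sq ha hz]
    field_simp
  · intro τ θ
    rw [abs_mul, abs_of_nonneg (sq_nonneg (Real.sin θ))]
    exact mul_le_one₀ (Real.abs_cos_le_one _) (sq_nonneg _) (Real.sin_sq_le_one θ)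

/-- The branch of `√(z² + a²)` that is analytic on the right half-plane and positive on the
positive real axis. -/
noncomputable def sqrtSqAddSq (a : ℝ) (z : ℂ) : ℂ :=
  (z - a * Complex.I) ^ (2⁻¹ : ℂ) * (z + a * Complex.I) ^ (2⁻¹ : ℂ)

lemma norm_cpow_inv_two_sq (z : ℂ) : ‖z ^ (2⁻¹ : ℂ)‖ ^ 2 = ‖z‖ := by
  rw [← norm_pow, Complex.cpow_ofNat_inv_pow]

lemma sqrtSqAddSq_ofReal {x : ℝ} (hx : 0 < x) (a : ℝ) :
    sqrtSqAddSq a x = Real.sqrt (x ^ 2 + a ^ 2) := by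
  have harg : (x + a * Complex.I : ℂ).arg ≠ Real.pi :=
    Complex.slitPlane_arg_ne_pi (Or.inl (by simpa using hx))
  have hconj : (x - a * Complex.I : ℂ) ^ (2⁻¹ : ℂ) =
      (starRingEnd ℂ) ((x + a * Complex.I : ℂ) ^ (2⁻¹ : ℂ)) := by
    have h := Complex.conj_cpow _ (2⁻¹ : ℂ) harg
    have h2 : (starRingEnd ℂ) (2⁻¹ : ℂ) = 2⁻¹ := by rw [map_inv₀, Complex.conj_ofNat]
    rw [h2] at h
    simpa [← sub_eq_add_neg] using h
  rw [sqrtSqAddSq, hconj, mul_comm, Complex.mul_conj, Complex.normSq_eq_norm_sq,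
    norm_cpow_inv_two_sq, Complex.norm_add_mul_I]

lemma norm_sqrtSqAddSq_le {a : ℝ} (ha : 0 < a) (z : ℂ) : ‖sqrtSqAddSq a z‖ ≤ ‖z‖ + a := by
  refine le_of_sq_le_sq ?_ (by positivity)
  have hI : ‖(a * Complex.I : ℂ)‖ = a := by simp [abs_of_pos ha]
  rw [sqrtSqAddSq, norm_mul, mul_pow, norm_cpow_inv_two_sq, norm_cpow_inv_two_sq, sq]
  gcongr
  · exact (norm_sub_le _ _).trans_eq (by rw [hI])
  · exact (norm_add_le _ _).trans_eq (by rw [hI])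

lemma differentiableOn_sqrtSqAddSq (a : ℝ) :
    DifferentiableOn ℂ (sqrtSqAddSq a) {z | 0 < z.re} := by
  intro z hz
  refine DifferentiableAt.differentiableWithinAt ?_
  unfold sqrtSqAddSq
  refine DifferentiableAt.mul ?_ ?_
  · exact (differentiableAt_id.sub_const _).cpow_const (Or.inl (by simpa using hz))
  · exact (differentiableAt_id.add_const _).cpow_const (Or.inl (by simpa using hz))

lemma continuousAt_sqrtSqAddSq (a : ℝ) {z : ℂ} (hz : 0 ≤ z.re) :
    ContinuousAt (sqrtSqAddSq a) z := by
  unfold sqrtSqAddSq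
  refine ContinuousAt.mul ?_ ?_
  · exact ContinuousAt.comp (f := fun z : ℂ => z - a * Complex.I) (g := fun w : ℂ => w ^ (2⁻¹ : ℂ))
      (Complex.continuousAt_cpow_const_of_re_pos (Or.inl (by simpa using hz)) (by norm_num))
      (by fun_prop)
  · exact ContinuousAt.comp (f := fun z : ℂ => z + a * Complex.I) (g := fun w : ℂ => w ^ (2⁻¹ : ℂ))
      (Complex.continuousAt_cpow_const_of_re_pos (Or.inl (by simpa using hz)) (by norm_num))
      (by fun_prop)

/-- Boundary values on the imaginary axis; the right side is `0` when `|y| ≤ a`. -/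
lemma im_sqrtSqAddSq_mul_I {a y : ℝ} (hy : -a < y) :
    (sqrtSqAddSq a (y * Complex.I)).im = Real.sqrt (y ^ 2 - a ^ 2) := by
  have hre : ∀ u : ℝ, ((u * Complex.I : ℂ) ^ (2⁻¹ : ℂ)).re = Real.sqrt (|u| / 2) := fun u => by
    rw [Complex.cpow_inv_two_re]
    simp
  have him : ∀ u : ℝ, 0 ≤ u →
      ((u * Complex.I : ℂ) ^ (2⁻¹ : ℂ)).im = Real.sqrt (|u| / 2) := fun u hu => by
    rw [Complex.cpow_inv_two_im_eq_sqrt (by simpa using hu)]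
    simp
  have him' : ∀ u : ℝ, u < 0 →
      ((u * Complex.I : ℂ) ^ (2⁻¹ : ℂ)).im = -Real.sqrt (|u| / 2) := fun u hu => by
    rw [Complex.cpow_inv_two_im_eq_neg_sqrt (by simpa using hu)]
    simp
  have hsub : (y * Complex.I - a * Complex.I : ℂ) = (y - a : ℝ) * Complex.I := by
    push_cast; ring
  have hadd : (y * Complex.I + a * Complex.I : ℂ) = (y + a : ℝ) * Complex.I := by
    push_cast; ring
  have hpos : 0 ≤ y + a := by linarith
  rw [sqrtSqAddSq, hsub, hadd, Complex.mul_im, hre, hre, him _ hpos]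
  rcases le_or_gt a y with h | h
  · have h0 : 0 ≤ y - a := by linarith
    rw [him _ h0, ← two_mul, abs_of_nonneg h0, abs_of_nonneg hpos,
      ← Real.sqrt_mul (by linarith), ← Real.sqrt_sq (by norm_num : (0:ℝ) ≤ 2),
      ← Real.sqrt_mul (by positivity), Real.sqrt_sq (by norm_num : (0:ℝ) ≤ 2)]
    congr 1
    ring
  · have h0 : Real.sqrt (y ^ 2 - a ^ 2) = 0 := Real.sqrt_eq_zero_of_nonpos (by nlinarith)
    rw [him' _ (by linarith), h0]
    ring

lemma hasDerivAt_integral_cexp_neg_mul_poissonJ (a : ℝ) {z : ℂ} (hz : 0 < z.re) :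
    HasDerivAt (fun z : ℂ => ∫ τ in Set.Ioi (0:ℝ), Complex.exp (-(z * τ)) * (poissonJ (a * τ) : ℂ))
      (∫ τ in Set.Ioi (0:ℝ), Complex.exp (-(z * τ)) * (-τ) * (poissonJ (a * τ) : ℂ)) z := by
  have hJ : Continuous poissonJ := continuous_poissonJ
  have hs : {w : ℂ | z.re / 2 < w.re} ∈ nhds z :=
    (isOpen_lt continuous_const Complex.continuous_re).mem_nhds
      (show z.re / 2 < z.re by linarith)
  refine (hasDerivAt_integral_of_dominated_loc_of_deriv_le
    (F := fun (z : ℂ) (τ : ℝ) => Complex.exp (-(z * τ)) * (poissonJ (a * τ) : ℂ))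
    (F' := fun (z : ℂ) (τ : ℝ) => Complex.exp (-(z * τ)) * (-τ) * (poissonJ (a * τ) : ℂ))
    (bound := fun τ => τ * Real.exp (-(z.re / 2 * τ))) hs
    (Eventually.of_forall fun w => Continuous.aestronglyMeasurable (by fun_prop)) ?_
    (Continuous.aestronglyMeasurable (by fun_prop)) ?_
    (integrableOn_id_mul_exp_neg_mul_Ioi (by linarith)) ?_).2
  · refine Integrable.mono' (integrableOn_exp_neg_mul_Ioi hz)
      (Continuous.aestronglyMeasurable (by fun_prop)) (ae_of_all _ fun τ => ?_)
    rw [norm_mul, Complex.norm_exp, Complex.norm_real]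
    simp only [Complex.neg_re, Complex.mul_re, Complex.ofReal_re, Complex.ofReal_im, mul_zero,
      sub_zero]
    exact mul_le_of_le_one_right (Real.exp_pos _).le (abs_poissonJ_le_one _)
  · refine (ae_restrict_iff' measurableSet_Ioi).2 (ae_of_all _ fun τ hτ w hw => ?_)
    have hτ' : 0 < τ := hτ
    rw [norm_mul, norm_mul, Complex.norm_exp, Complex.norm_real, norm_neg, Complex.norm_real]
    simp only [Complex.neg_re, Complex.mul_re, Complex.ofReal_re, Complex.ofReal_im, mul_zero,
      sub_zero]
    refine (mul_le_of_le_one_right (by positivity) (abs_poissonJ_le_one _)).trans ?_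
    rw [Real.norm_of_nonneg hτ'.le, mul_comm]
    have hw' : z.re / 2 < w.re := hw
    gcongr
  · refine ae_of_all _ fun τ w _ => ?_
    have h := (((hasDerivAt_id w).mul_const (τ : ℂ)).neg.cexp).mul_const (poissonJ (a * τ) : ℂ)
    simpa using h

/-- Laplace transform of `J₁(aτ) / (aτ)` on the right half-plane. -/
lemma integral_cexp_neg_mul_poissonJ {a : ℝ} (ha : 0 < a) {z : ℂ} (hz : 0 < z.re) :
    ∫ τ in Set.Ioi (0:ℝ), Complex.exp (-(z * τ)) * (poissonJ (a * τ) : ℂ) =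
      (sqrtSqAddSq a z - z) / a ^ 2 := by
  have hopen : IsOpen {z : ℂ | 0 < z.re} := isOpen_lt continuous_const Complex.continuous_re
  have hconn : IsPreconnected {z : ℂ | 0 < z.re} :=
    (convex_halfSpace_re_gt 0).isPreconnected
  have hf : AnalyticOnNhd ℂ (fun z : ℂ => ∫ τ in Set.Ioi (0:ℝ),
      Complex.exp (-(z * τ)) * (poissonJ (a * τ) : ℂ)) {z | 0 < z.re} :=
    DifferentiableOn.analyticOnNhd (fun w hw =>
      (hasDerivAt_integral_cexp_neg_mul_poissonJ a hw).differentiableAt.differentiableWithinAt) hopen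
  have hg : AnalyticOnNhd ℂ (fun z : ℂ => (sqrtSqAddSq a z - z) / a ^ 2) {z | 0 < z.re} :=
    DifferentiableOn.analyticOnNhd
      (((differentiableOn_sqrtSqAddSq a).sub differentiableOn_id).div_const _) hopen
  refine hf.eqOn_of_preconnected_of_frequently_eq hg hconn (z₀ := ((1:ℝ) : ℂ)) (by simp) ?_ hz
  have htend : Tendsto (fun x : ℝ => (x : ℂ)) (nhdsWithin 1 {1}ᶜ)
      (nhdsWithin ((1:ℝ) : ℂ) {((1:ℝ) : ℂ)}ᶜ) :=
    (Complex.continuous_ofReal.continuousWithinAt).tendsto_nhdsWithin fun x hx => by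
      simpa using hx
  refine htend.frequently (Eventually.frequently ?_)
  filter_upwards [nhdsWithin_le_nhds (Ioi_mem_nhds (zero_lt_one (α := ℝ)))] with x hx
  have hx' : 0 < x := hx
  rw [sqrtSqAddSq_ofReal hx']
  have h := congrArg (fun r : ℝ => (r : ℂ)) (integral_exp_neg_mul_poissonJ ha hx')
  simp only [← integral_complex_ofReal] at h
  push_cast at h
  exact h

lemma integral_exp_neg_mul_sin_mul_poissonJ {a ε : ℝ} (ha : 0 < a) (hε : 0 < ε) (y : ℝ) :
    ∫ τ in Set.Ioi (0:ℝ), Real.exp (-(ε * τ)) * Real.sin (y * τ) * poissonJ (a * τ) =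
      (y - (sqrtSqAddSq a (ε + y * Complex.I)).im) / a ^ 2 := by
  have hJ : Continuous poissonJ := continuous_poissonJ
  have hre : (ε + y * Complex.I : ℂ).re = ε := by simp
  have hint : IntegrableOn (fun τ : ℝ => Complex.exp (-((ε + y * Complex.I) * τ)) *
      (poissonJ (a * τ) : ℂ)) (Set.Ioi 0) := by
    refine Integrable.mono' (integrableOn_exp_neg_mul_Ioi hε)
      (Continuous.aestronglyMeasurable (by fun_prop)) (ae_of_all _ fun τ => ?_)
    rw [norm_mul, Complex.norm_exp, Complex.norm_real]
    simp only [Complex.neg_re, Complex.mul_re, hre, Complex.ofReal_re, Complex.ofReal_im, mul_zero,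
      sub_zero]
    exact mul_le_of_le_one_right (Real.exp_pos _).le (abs_poissonJ_le_one _)
  have h := congrArg Complex.im (integral_cexp_neg_mul_poissonJ ha (z := ε + y * Complex.I)
    (by rwa [hre]))
  have him := integral_im hint
  simp only [RCLike.im_to_complex] at him
  rw [← him] at h
  have hR : ((sqrtSqAddSq a (ε + y * Complex.I) - (ε + y * Complex.I)) / (a : ℂ) ^ 2).im =
      -((y - (sqrtSqAddSq a (ε + y * Complex.I)).im) / a ^ 2) := by
    rw [← Complex.ofReal_pow, Complex.div_ofReal_im]
    simp
    ring
  rw [hR] at h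
  rw [← neg_eq_iff_eq_neg.2 h, ← integral_neg]
  refine setIntegral_congr_fun measurableSet_Ioi fun τ _ => ?_
  simp [Complex.exp_im, Complex.mul_im, Complex.exp_re]

lemma integrable_inv_sq_add_sq {p : ℝ} (hp : 0 < p) :
    Integrable fun τ : ℝ => 1 / (τ ^ 2 + p ^ 2) := by
  refine Integrable.mono' (integrable_inv_one_add_sq.const_mul (1 + 1 / p ^ 2))
    (Continuous.aestronglyMeasurable (continuous_const.div (by fun_prop) fun τ => by positivity))
    (ae_of_all _ fun τ => ?_)
  rw [Real.norm_of_nonneg (by positivity), ← div_eq_mul_inv,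
    div_le_div_iff₀ (by positivity) (by positivity), one_mul]
  have h : (1 + 1 / p ^ 2) * (τ ^ 2 + p ^ 2) = 1 + τ ^ 2 + p ^ 2 + τ ^ 2 / p ^ 2 := by
    field_simp
    ring
  rw [h]
  have : 0 ≤ τ ^ 2 / p ^ 2 := by positivity
  nlinarith [sq_nonneg p]

lemma integrable_besselJ_one_div {p : ℝ} (hp : 0 < p) (a : ℝ) :
    Integrable fun τ : ℝ => 1 / (τ ^ 2 + p ^ 2) * besselJ 1 (a * τ) :=
  (integrable_inv_sq_add_sq hp).mul_bdd (c := 1)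
    (continuous_besselJ_one.comp (by fun_prop)).aestronglyMeasurable
    (ae_of_all _ fun τ => abs_besselJ_one_le_one (a * τ))

lemma integrableOn_exp_neg_mul_sin_mul_poissonJ {ε : ℝ} (hε : 0 < ε) (a y : ℝ) :
    IntegrableOn (fun τ => Real.exp (-(ε * τ)) * Real.sin (y * τ) * poissonJ (a * τ))
      (Set.Ioi 0) := by
  have hJ : Continuous poissonJ := continuous_poissonJ
  refine Integrable.mono' (integrableOn_exp_neg_mul_Ioi hε)
    (Continuous.aestronglyMeasurable (by fun_prop)) (ae_of_all _ fun τ => ?_)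
  rw [Real.norm_eq_abs, abs_mul, abs_mul, Real.abs_exp, mul_assoc]
  exact mul_le_of_le_one_right (Real.exp_pos _).le
    (mul_le_one₀ (Real.abs_sin_le_one _) (abs_nonneg _) (abs_poissonJ_le_one _))

lemma integral_exp_neg_mul_besselJ_one_mul_cos {a p ε : ℝ} (ha : 0 < a) (hp : 0 < p) (hε : 0 < ε)
    (x : ℝ) :
    ∫ τ in Set.Ioi (0:ℝ),
        Real.exp (-(ε * τ)) * (1 / (τ ^ 2 + p ^ 2) * besselJ 1 (a * τ) * Real.cos (x * τ)) =
      ∫ s in Set.Ioi (0:ℝ), Real.exp (-(p * s)) * ((2 * s -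
        (sqrtSqAddSq a (ε + (s + x : ℝ) * Complex.I)).im -
        (sqrtSqAddSq a (ε + (s - x : ℝ) * Complex.I)).im) / (2 * a)) := by
  have hJ : Continuous poissonJ := continuous_poissonJ
  have hleft : ∀ τ : ℝ,
      Real.exp (-(ε * τ)) * (1 / (τ ^ 2 + p ^ 2) * besselJ 1 (a * τ) * Real.cos (x * τ)) =
      ∫ s in Set.Ioi (0:ℝ), a * Real.exp (-(ε * τ)) * poissonJ (a * τ) * Real.cos (x * τ) *
        (Real.exp (-(p * s)) * Real.sin (τ * s)) := fun τ => by
    rw [integral_const_mul, integral_exp_neg_mul_sin_Ioi hp, besselJ_one_eq_mul_poissonJ]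
    ring
  simp only [hleft]
  rw [integral_integral_swap]
  · refine setIntegral_congr_fun measurableSet_Ioi fun s _ => ?_
    have hsplit : ∀ τ, a * Real.exp (-(ε * τ)) * poissonJ (a * τ) * Real.cos (x * τ) *
        (Real.exp (-(p * s)) * Real.sin (τ * s)) = Real.exp (-(p * s)) * (a / 2) *
          (Real.exp (-(ε * τ)) * Real.sin ((s + x) * τ) * poissonJ (a * τ) +
            Real.exp (-(ε * τ)) * Real.sin ((s - x) * τ) * poissonJ (a * τ)) := fun τ => by
      rw [add_mul s x τ, sub_mul s x τ, Real.sin_add, Real.sin_sub, mul_comm τ s]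
      ring
    simp only [hsplit]
    rw [integral_const_mul, integral_add (integrableOn_exp_neg_mul_sin_mul_poissonJ hε _ _)
      (integrableOn_exp_neg_mul_sin_mul_poissonJ hε _ _),
      integral_exp_neg_mul_sin_mul_poissonJ ha hε, integral_exp_neg_mul_sin_mul_poissonJ ha hε]
    field_simp
    ring
  · refine Integrable.mono' (((integrableOn_exp_neg_mul_Ioi hε).const_mul a).mul_prod
      (integrableOn_exp_neg_mul_Ioi hp)) (Continuous.aestronglyMeasurable (by
        simp only [Function.uncurry_def]; fun_prop)) (ae_of_all _ fun q => ?_)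
    simp only [Function.uncurry_def, Real.norm_eq_abs, abs_mul, Real.abs_exp, abs_of_pos ha]
    have h1 := abs_poissonJ_le_one (a * q.1)
    have h2 := Real.abs_cos_le_one (x * q.1)
    have h3 := Real.abs_sin_le_one (q.1 * q.2)
    refine mul_le_mul ?_ (mul_le_of_le_one_right (Real.exp_pos _).le h3) (by positivity)
      (by positivity)
    rw [mul_assoc]
    exact mul_le_of_le_one_right (by positivity) (mul_le_one₀ h1 (abs_nonneg _) h2)

lemma tendsto_im_sqrtSqAddSq {a y : ℝ} (hy : -a < y) :
    Tendsto (fun ε : ℝ => (sqrtSqAddSq a (ε + y * Complex.I)).im) (nhdsWithin 0 (Set.Ioi 0))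
      (nhds (Real.sqrt (y ^ 2 - a ^ 2))) := by
  have hcont : ContinuousAt (fun ε : ℝ => (sqrtSqAddSq a (ε + y * Complex.I)).im) 0 := by
    refine Complex.continuous_im.continuousAt.comp
      (ContinuousAt.comp (f := fun ε : ℝ => (ε + y * Complex.I : ℂ)) (g := sqrtSqAddSq a)
        (continuousAt_sqrtSqAddSq a (by simp)) (by fun_prop))
  have h := hcont.tendsto
  simp only [Complex.ofReal_zero, zero_add, im_sqrtSqAddSq_mul_I hy] at h
  exact h.mono_left nhdsWithin_le_nhds

lemma integrableOn_exp_neg_mul_sqrt {a p x : ℝ} (hp : 0 < p) (hx : |x| < a) :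
    IntegrableOn (fun s => Real.exp (-(p * s)) * Real.sqrt ((s - x) ^ 2 - a ^ 2))
      (Set.Ioi 0) := by
  refine Integrable.mono' ((integrableOn_id_mul_exp_neg_mul_Ioi hp).add
    ((integrableOn_exp_neg_mul_Ioi hp).const_mul a))
    (Continuous.aestronglyMeasurable (by fun_prop)) ?_
  refine (ae_restrict_iff' measurableSet_Ioi).2 (ae_of_all _ fun s hs => ?_)
  have hs' : 0 < s := hs
  rw [Real.norm_of_nonneg (by positivity)]
  have hle : Real.sqrt ((s - x) ^ 2 - a ^ 2) ≤ s + a := by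
    obtain ⟨h1, h2⟩ := abs_lt.1 hx
    exact Real.sqrt_le_iff.2 ⟨by linarith, by nlinarith⟩
  simp only [Pi.add_apply]
  nlinarith [Real.exp_pos (-(p * s))]

lemma integral_exp_neg_mul_sqrt {a p x : ℝ} (hp : 0 < p) (hx : |x| < a) :
    ∫ s in Set.Ioi (0:ℝ), Real.exp (-(p * s)) * Real.sqrt ((s - x) ^ 2 - a ^ 2) =
      Real.exp (-(p * x)) * (a / p * besselK 1 (a * p)) := by
  obtain ⟨h1, h2⟩ := abs_lt.1 hx
  have ha : 0 < a := (abs_nonneg x).trans_lt hx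
  have hshift := (measurePreserving_sub_right volume x).setIntegral_preimage_emb
    (measurableEmbedding_subRight x)
    (fun y => Real.exp (-(p * x)) * (Real.exp (-(p * y)) * Real.sqrt (y ^ 2 - a ^ 2))) (Set.Ioi a)
  rw [← integral_exp_neg_mul_sqrt_sq_sub_sq ha hp, ← integral_const_mul,
    setIntegral_eq_of_subset_of_forall_sdiff_eq_zero (s := Set.Ioi (a + x)) measurableSet_Ioi
      (Set.Ioi_subset_Ioi (by linarith)), ← hshift, Set.preimage_sub_const_Ioi]
  · refine setIntegral_congr_fun measurableSet_Ioi fun s _ => ?_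
    simp only [← mul_assoc, ← Real.exp_add]
    ring_nf
  · rintro s ⟨hs, hs'⟩
    have hs0 : 0 < s := hs
    have hsa : s ≤ a + x := not_lt.1 hs'
    rw [Real.sqrt_eq_zero_of_nonpos (by nlinarith), mul_zero]

lemma norm_sqrtSqAddSq_le_of_le_one {a ε y : ℝ} (ha : 0 < a) (h0 : 0 < ε) (h1 : ε ≤ 1) :
    |(sqrtSqAddSq a (ε + y * Complex.I)).im| ≤ 1 + |y| + a := by
  refine (Complex.abs_im_le_norm _).trans ((norm_sqrtSqAddSq_le ha _).trans ?_)
  gcongr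
  refine (norm_add_le _ _).trans ?_
  rw [norm_mul, Complex.norm_I, mul_one, Complex.norm_real, Complex.norm_real,
    Real.norm_of_nonneg h0.le, Real.norm_eq_abs]
  gcongr

/-- The cosine transform of `J₁(aτ) / (τ² + p²)` on the interval `(-a, a)`. -/
lemma integral_besselJ_one_mul_cos {a p x : ℝ} (hp : 0 < p) (hx : |x| < a) :
    ∫ τ in Set.Ioi (0:ℝ), 1 / (τ ^ 2 + p ^ 2) * besselJ 1 (a * τ) * Real.cos (x * τ) =
      1 / (a * p ^ 2) - p⁻¹ * besselK 1 (a * p) * Real.cosh (p * x) := by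
  have ha : 0 < a := (abs_nonneg x).trans_lt hx
  obtain ⟨hx1, hx2⟩ := abs_lt.1 hx
  have hJ := continuous_besselJ_one
  have hinv : Continuous fun τ : ℝ => 1 / (τ ^ 2 + p ^ 2) :=
    continuous_const.div (by fun_prop) fun τ => by positivity
  have hleft : Tendsto (fun ε : ℝ => ∫ τ in Set.Ioi (0:ℝ),
      Real.exp (-(ε * τ)) * (1 / (τ ^ 2 + p ^ 2) * besselJ 1 (a * τ) * Real.cos (x * τ)))
      (nhdsWithin 0 (Set.Ioi 0)) (nhds (∫ τ in Set.Ioi (0:ℝ),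
        1 / (τ ^ 2 + p ^ 2) * besselJ 1 (a * τ) * Real.cos (x * τ))) := by
    refine tendsto_integral_filter_of_dominated_convergence (fun τ => 1 / (τ ^ 2 + p ^ 2))
      (Eventually.of_forall fun ε => Continuous.aestronglyMeasurable (by fun_prop)) ?_
      (integrable_inv_sq_add_sq hp).integrableOn (ae_of_all _ fun τ => ?_)
    · filter_upwards [self_mem_nhdsWithin] with ε hε
      have hε' : 0 < ε := hε
      refine (ae_restrict_iff' measurableSet_Ioi).2 (ae_of_all _ fun τ hτ => ?_)
      have hτ' : 0 < τ := hτ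
      have hpos : 0 ≤ 1 / (τ ^ 2 + p ^ 2) := by positivity
      rw [Real.norm_eq_abs, abs_mul, abs_mul, abs_mul, Real.abs_exp, abs_of_nonneg hpos]
      have he : Real.exp (-(ε * τ)) ≤ 1 := Real.exp_le_one_iff.2 (by nlinarith)
      refine (mul_le_of_le_one_left (by positivity) he).trans ?_
      rw [mul_assoc]
      exact mul_le_of_le_one_right hpos
        (mul_le_one₀ (abs_besselJ_one_le_one _) (abs_nonneg _) (Real.abs_cos_le_one _))
    · have hc : Continuous fun ε : ℝ => Real.exp (-(ε * τ)) *
          (1 / (τ ^ 2 + p ^ 2) * besselJ 1 (a * τ) * Real.cos (x * τ)) := by fun_prop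
      have h := (hc.tendsto 0).mono_left (nhdsWithin_le_nhds (s := Set.Ioi 0))
      simpa only [zero_mul, neg_zero, Real.exp_zero, one_mul] using h
  have hright : Tendsto (fun ε : ℝ => ∫ s in Set.Ioi (0:ℝ), Real.exp (-(p * s)) * ((2 * s -
        (sqrtSqAddSq a (ε + (s + x : ℝ) * Complex.I)).im -
        (sqrtSqAddSq a (ε + (s - x : ℝ) * Complex.I)).im) / (2 * a)))
      (nhdsWithin 0 (Set.Ioi 0)) (nhds (∫ s in Set.Ioi (0:ℝ), Real.exp (-(p * s)) * ((2 * s -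
        Real.sqrt ((s + x) ^ 2 - a ^ 2) - Real.sqrt ((s - x) ^ 2 - a ^ 2)) / (2 * a)))) := by
    refine tendsto_integral_filter_of_dominated_convergence
      (fun s => 2 / a * (s * Real.exp (-(p * s))) + (1 + 2 * a) / a * Real.exp (-(p * s)))
      (Eventually.of_forall fun ε => Measurable.aestronglyMeasurable (by
        unfold sqrtSqAddSq; fun_prop)) ?_
      (((integrableOn_id_mul_exp_neg_mul_Ioi hp).const_mul _).add
        ((integrableOn_exp_neg_mul_Ioi hp).const_mul _)) ?_
    · filter_upwards [self_mem_nhdsWithin,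
        nhdsWithin_le_nhds (Iic_mem_nhds (zero_lt_one (α := ℝ)))] with ε hε hε1
      refine (ae_restrict_iff' measurableSet_Ioi).2 (ae_of_all _ fun s hs => ?_)
      have hs' : 0 < s := hs
      have b1 := norm_sqrtSqAddSq_le_of_le_one (y := s + x) ha hε hε1
      have b2 := norm_sqrtSqAddSq_le_of_le_one (y := s - x) ha hε hε1
      have c1 : |s + x| ≤ s + a := abs_le.2 ⟨by linarith, by linarith⟩
      have c2 : |s - x| ≤ s + a := abs_le.2 ⟨by linarith, by linarith⟩
      have h2a : (0:ℝ) < 2 * a := by linarith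
      rw [Real.norm_eq_abs, abs_mul, Real.abs_exp, abs_div, abs_of_pos h2a]
      have hnum : |2 * s - (sqrtSqAddSq a (ε + (s + x : ℝ) * Complex.I)).im -
          (sqrtSqAddSq a (ε + (s - x : ℝ) * Complex.I)).im| ≤ 4 * s + 2 + 4 * a := by
        rw [abs_le] at b1 b2 ⊢
        constructor <;> linarith
      calc _ ≤ Real.exp (-(p * s)) * ((4 * s + 2 + 4 * a) / (2 * a)) := by gcongr
        _ = _ := by field_simp; ring
    · refine (ae_restrict_iff' measurableSet_Ioi).2 (ae_of_all _ fun s hs => ?_)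
      have hs' : 0 < s := hs
      exact ((((tendsto_im_sqrtSqAddSq (by linarith)).const_sub (2 * s)).sub
        (tendsto_im_sqrtSqAddSq (by linarith))).div_const (2 * a)).const_mul _
  have heq := tendsto_nhds_unique hleft (hright.congr' (by
    filter_upwards [self_mem_nhdsWithin] with ε hε
    exact (integral_exp_neg_mul_besselJ_one_mul_cos ha hp hε x).symm))
  have hneg : |-x| < a := by rwa [abs_neg]
  have hi1 := integrableOn_exp_neg_mul_sqrt hp hneg
  have hi2 := integrableOn_exp_neg_mul_sqrt hp hx
  have hv1 := integral_exp_neg_mul_sqrt hp hneg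
  have hv2 := integral_exp_neg_mul_sqrt hp hx
  simp only [sub_neg_eq_add] at hi1 hv1
  have hsplit : ∀ s, Real.exp (-(p * s)) * ((2 * s -
        Real.sqrt ((s + x) ^ 2 - a ^ 2) - Real.sqrt ((s - x) ^ 2 - a ^ 2)) / (2 * a)) =
      1 / a * (s * Real.exp (-(p * s))) - 1 / (2 * a) *
        (Real.exp (-(p * s)) * Real.sqrt ((s + x) ^ 2 - a ^ 2) +
          Real.exp (-(p * s)) * Real.sqrt ((s - x) ^ 2 - a ^ 2)) := fun s => by
    field_simp
    ring
  have hi12 : IntegrableOn (fun s => Real.exp (-(p * s)) * Real.sqrt ((s + x) ^ 2 - a ^ 2) +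
      Real.exp (-(p * s)) * Real.sqrt ((s - x) ^ 2 - a ^ 2)) (Set.Ioi 0) := hi1.add hi2
  rw [heq]
  simp only [hsplit]
  rw [integral_sub ((integrableOn_id_mul_exp_neg_mul_Ioi hp).const_mul _)
    (hi12.const_mul _), integral_const_mul, integral_const_mul,
    integral_add hi1 hi2, hv1, hv2, integral_id_mul_exp_neg_mul_Ioi hp, Real.cosh_eq]
  field_simp

lemma integral_besselJ_one_mul_sin_mul_sin {a p u v : ℝ} (hp : 0 < p) (huv : |u| + |v| < a) :
    ∫ τ in Set.Ioi (0:ℝ), 1 / (τ ^ 2 + p ^ 2) * besselJ 1 (a * τ) * Real.sin (v * τ) *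
        Real.sin (u * τ) =
      p⁻¹ * besselK 1 (a * p) * Real.sinh (p * v) * Real.sinh (p * u) := by
  have hint : ∀ x : ℝ, IntegrableOn
      (fun τ => 1 / (τ ^ 2 + p ^ 2) * besselJ 1 (a * τ) * Real.cos (x * τ)) (Set.Ioi 0) :=
    fun x => ((integrable_besselJ_one_div hp a).mul_bdd (c := 1)
      (Continuous.aestronglyMeasurable (by fun_prop))
      (ae_of_all _ fun τ => Real.abs_cos_le_one (x * τ))).integrableOn
  have hsplit : ∀ τ, 1 / (τ ^ 2 + p ^ 2) * besselJ 1 (a * τ) * Real.sin (v * τ) *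
      Real.sin (u * τ) =
      1 / 2 * (1 / (τ ^ 2 + p ^ 2) * besselJ 1 (a * τ) * Real.cos ((u - v) * τ) -
        1 / (τ ^ 2 + p ^ 2) * besselJ 1 (a * τ) * Real.cos ((u + v) * τ)) := fun τ => by
    rw [sub_mul, add_mul, Real.cos_sub, Real.cos_add]
    ring
  simp only [hsplit]
  rw [integral_const_mul, integral_sub (hint _) (hint _),
    integral_besselJ_one_mul_cos hp ((abs_sub u v).trans_lt huv),
    integral_besselJ_one_mul_cos hp ((abs_add_le u v).trans_lt huv), mul_sub p, mul_add p,
    Real.cosh_sub, Real.cosh_add]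
  ring

lemma integral_mul_besselJ_one_of_integral_mul_sin {Q : ℝ → ℝ} (hQ : IntegrableOn Q (Set.Ioi 0))
    {b p C : ℝ} (hb : 0 ≤ b)
    (h : ∀ u, |u| ≤ b →
      ∫ τ in Set.Ioi (0:ℝ), Q τ * Real.sin (u * τ) = C * Real.sinh (p * u)) :
    ∫ τ in Set.Ioi (0:ℝ), Q τ * besselJ 1 (b * τ) = C * besselI 1 (b * p) := by
  simp only [besselJ_one_eq_integral_sin, besselI_one_eq_integral_sinh, mul_left_comm _ Real.pi⁻¹]
  rw [integral_const_mul, integral_mul_intervalIntegral_swap hQ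
    (k := fun τ θ => Real.sin (b * τ * Real.cos θ) * Real.cos θ)
    (by simp only [Function.uncurry_def]; fun_prop)
    (fun τ θ => by
      rw [abs_mul]
      exact mul_le_one₀ (Real.abs_sin_le_one _) (abs_nonneg _) (Real.abs_cos_le_one θ))]
  congr 1
  rw [← intervalIntegral.integral_const_mul]
  refine intervalIntegral.integral_congr fun θ _ => ?_
  have hθ : |b * Real.cos θ| ≤ b := by
    rw [abs_mul, abs_of_nonneg hb]
    exact mul_le_of_le_one_right hb (Real.abs_cos_le_one θ)
  simp only [← mul_assoc, mul_right_comm b _ (Real.cos θ)]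
  rw [integral_mul_const, h _ hθ]
  ring_nf

theorem bessel_integral_formula_two (a b c p : ℝ) (hb : 0 < b) (hc : 0 < c) (hp : 0 < p)
    (habc : b + c < a) :
    ∫ τ in Set.Ioi (0:ℝ),
        1 / (τ ^ 2 + p ^ 2) * besselJ 1 (a * τ) * besselJ 1 (b * τ) * besselJ 1 (c * τ)
      = p⁻¹ * besselK 1 (a * p) * besselI 1 (b * p) * besselI 1 (c * p) := by
  have hQ := integrable_besselJ_one_div hp a
  refine integral_mul_besselJ_one_of_integral_mul_sin ?_ hc.le fun v hv => ?_
  · exact (hQ.mul_bdd (c := 1) (continuous_besselJ_one.comp (by fun_prop)).aestronglyMeasurable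
      (ae_of_all _ fun τ => abs_besselJ_one_le_one (b * τ))).integrableOn
  · simp only [mul_right_comm _ (besselJ 1 (b * _)), mul_right_comm _ (besselI 1 (b * p))]
    refine integral_mul_besselJ_one_of_integral_mul_sin ?_ hb.le fun u hu =>
      integral_besselJ_one_mul_sin_mul_sin hp (by linarith)
    exact (hQ.mul_bdd (c := 1) (Continuous.aestronglyMeasurable (by fun_prop))
      (ae_of_all _ fun τ => Real.abs_sin_le_one (v * τ))).integrableOn
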